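/- arXiv:1303.1838 — 12 statements merged into one kernel-verified Lean document; each statement's English description precedes it below -/
import Mathlib

section
/- Let a and b be integers with a ≥ 2 and b ≥ 2. Then the simple continued fraction expansion of √(a²b²−b) is [ab−1; 1, 2a−2, 1, 2ab−2] with period (1, 2a−2, 1, 2ab−2); that is, the sequence of partial quotients of √(a²b²−b) is a₀ = ab−1 followed by the periodic repetition of the block (1, 2a−2, 1, 2ab−2). -/
/-- If `v = m + y⁻¹` with `y > 1`, then `⌊v⌋ = m`. -/
theorem floor_eq_of_eq_add_inv {v y : ℝ} {m : ℤ} (hy : 1 < y) (hv : v = m + y⁻¹) : ⌊v⌋ = m := by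
  have h0 : 0 < y⁻¹ := inv_pos.2 (by linarith)
  have h1 : y⁻¹ < 1 := inv_lt_one_of_one_lt₀ hy
  rw [Int.floor_eq_iff]
  constructor <;> linarith

/-- If `v = m + y⁻¹` with `y > 1`, then `fract v = y⁻¹`. -/
theorem fract_eq_of_eq_add_inv {v y : ℝ} {m : ℤ} (hy : 1 < y) (hv : v = m + y⁻¹) :
    Int.fract v = y⁻¹ := by
  rw [Int.fract, floor_eq_of_eq_add_inv hy hv, hv]
  ring

/-- The first partial denominator of `m + y⁻¹` with `y > 1` is `⌊y⌋`. -/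
theorem partDens_zero_of_eq_add_inv {v y : ℝ} {m : ℤ} (hy : 1 < y) (hv : v = m + y⁻¹) :
    (GenContFract.of v).partDens.get? 0 = some (⌊y⌋ : ℝ) := by
  have hf := fract_eq_of_eq_add_inv hy hv
  have h0 : Int.fract v ≠ 0 := by
    rw [hf]
    exact inv_ne_zero (by linarith)
  have h := GenContFract.of_s_head h0
  rw [hf, inv_inv] at h
  exact GenContFract.partDen_eq_s_b h

/-- The partial denominators of `m + y⁻¹` with `y > 1` after the first are those of `y`. -/
theorem partDens_succ_of_eq_add_inv {v y : ℝ} {m : ℤ} (hy : 1 < y) (hv : v = m + y⁻¹) (n : ℕ) :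
    (GenContFract.of v).partDens.get? (n + 1) = (GenContFract.of y).partDens.get? n := by
  have h := GenContFract.of_s_succ v n
  rw [fract_eq_of_eq_add_inv hy hv, inv_inv] at h
  simp only [GenContFract.partDens, Stream'.Seq.map_get?, h]

/-- A real number whose first five complete quotients are `v, w, x, y, z`, where `z` has the same
fractional part as `v`, has purely 4-periodic partial denominators. -/
theorem partDens_get?_of_period_four {v w x y z : ℝ} {m p q r t : ℤ}
    (hw : 1 < w) (hx : 1 < x) (hy : 1 < y) (hz : 1 < z)
    (hvw : v = m + w⁻¹) (hwx : w = p + x⁻¹) (hxy : x = q + y⁻¹) (hyz : y = r + z⁻¹)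
    (hzw : z = t + w⁻¹) (n : ℕ) :
    (GenContFract.of v).partDens.get? n =
      some (if n % 4 = 0 then (p : ℝ) else if n % 4 = 1 then (q : ℝ)
        else if n % 4 = 2 then (r : ℝ) else (t : ℝ)) := by
  induction n using Nat.strong_induction_on with
  | _ n ih =>
    match n, ih with
    | 0, _ => simp [partDens_zero_of_eq_add_inv hw hvw, floor_eq_of_eq_add_inv hx hwx]
    | 1, _ =>
      simp [partDens_succ_of_eq_add_inv hw hvw 0, partDens_zero_of_eq_add_inv hx hwx,
        floor_eq_of_eq_add_inv hy hxy]
    | 2, _ =>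
      simp [partDens_succ_of_eq_add_inv hw hvw 1, partDens_succ_of_eq_add_inv hx hwx 0,
        partDens_zero_of_eq_add_inv hy hxy, floor_eq_of_eq_add_inv hz hyz]
    | 3, _ =>
      simp [partDens_succ_of_eq_add_inv hw hvw 2, partDens_succ_of_eq_add_inv hx hwx 1,
        partDens_succ_of_eq_add_inv hy hxy 0, partDens_zero_of_eq_add_inv hz hyz,
        floor_eq_of_eq_add_inv hw hzw]
    | k + 4, ih =>
      have hk : (GenContFract.of v).partDens.get? (k + 4) =
          (GenContFract.of v).partDens.get? k := by
        rw [partDens_succ_of_eq_add_inv hw hvw (k + 3), partDens_succ_of_eq_add_inv hx hwx (k + 2),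
          partDens_succ_of_eq_add_inv hy hxy (k + 1), partDens_succ_of_eq_add_inv hz hyz k]
        cases k with
        | zero => rw [partDens_zero_of_eq_add_inv hw hzw, partDens_zero_of_eq_add_inv hw hvw]
        | succ j => rw [partDens_succ_of_eq_add_inv hw hzw, partDens_succ_of_eq_add_inv hw hvw]
      rw [hk, ih k (by omega), Nat.add_mod_right]


/-- For integers `a ≥ 2` and `b ≥ 2`, the simple continued fraction expansion of
`√(a²b² − b)` is `[ab−1; 1, 2a−2, 1, 2ab−2]` with periodic block `(1, 2a−2, 1, 2ab−2)`:
the integer part is `ab − 1` and the `n`-th partial denominator cycles through this block. -/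
theorem cf_sqrt_a_sq_b_sq_sub_b (a b : ℤ) (ha : 2 ≤ a) (hb : 2 ≤ b) :
    (GenContFract.of (Real.sqrt ((a : ℝ) ^ 2 * (b : ℝ) ^ 2 - b))).h = (a : ℝ) * b - 1 ∧
    ∀ n : ℕ, (GenContFract.of (Real.sqrt ((a : ℝ) ^ 2 * (b : ℝ) ^ 2 - b))).partDens.get? n =
      some (if n % 4 = 0 then (1 : ℝ)
            else if n % 4 = 1 then (2 * a - 2 : ℝ)
            else if n % 4 = 2 then (1 : ℝ)
            else (2 * a * b - 2 : ℝ)) := by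
  have ha' : (2 : ℝ) ≤ a := by exact_mod_cast ha
  have hb' : (2 : ℝ) ≤ b := by exact_mod_cast hb
  have hab : 2 * (b : ℝ) ≤ a * b := by nlinarith
  have hd : (0 : ℝ) ≤ (a : ℝ) ^ 2 * (b : ℝ) ^ 2 - b := by nlinarith
  set s := Real.sqrt ((a : ℝ) ^ 2 * (b : ℝ) ^ 2 - b) with hs
  have hsq : s ^ 2 = (a : ℝ) ^ 2 * (b : ℝ) ^ 2 - b := Real.sq_sqrt hd
  have hlo : (a : ℝ) * b - 1 < s := Real.lt_sqrt_of_sq_lt (by nlinarith)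
  have hhi : s < (a : ℝ) * b := by
    rw [hs, Real.sqrt_lt' (by linarith)]
    nlinarith
  have hc : 0 < 2 * (a : ℝ) * b - 1 - b := by linarith
  have hw : 1 < (s + a * b - 1) / (2 * (a : ℝ) * b - 1 - b) := by
    rw [one_lt_div hc]; linarith
  have hx : 1 < (s + a * b - b) / (b : ℝ) := by
    rw [one_lt_div (by linarith)]; linarith
  have hy : 1 < (s + a * b - b) / (2 * (a : ℝ) * b - 1 - b) := by
    rw [one_lt_div hc]; linarith
  have hz : 1 < s + (a : ℝ) * b - 1 := by linarith
  have hs1' : s + (a : ℝ) * b - 1 ≠ 0 := by linarith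
  have hsb' : s + (a : ℝ) * b - b ≠ 0 := by linarith
  have hb0 : (b : ℝ) ≠ 0 := by linarith
  have hvw : s = ((a * b - 1 : ℤ) : ℝ) + ((s + a * b - 1) / (2 * (a : ℝ) * b - 1 - b))⁻¹ := by
    push_cast
    rw [inv_div]
    field_simp
    linear_combination hsq
  have hwx : (s + a * b - 1) / (2 * (a : ℝ) * b - 1 - b) =
      ((1 : ℤ) : ℝ) + ((s + a * b - b) / (b : ℝ))⁻¹ := by
    push_cast
    rw [inv_div, div_eq_iff hc.ne']
    field_simp
    linear_combination hsq
  have hxy : (s + a * b - b) / (b : ℝ) = ((2 * a - 2 : ℤ) : ℝ) +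
      ((s + a * b - b) / (2 * (a : ℝ) * b - 1 - b))⁻¹ := by
    push_cast
    rw [inv_div]
    field_simp
    linear_combination hsq
  have hyz : (s + a * b - b) / (2 * (a : ℝ) * b - 1 - b) =
      ((1 : ℤ) : ℝ) + (s + (a : ℝ) * b - 1)⁻¹ := by
    push_cast
    rw [div_eq_iff hc.ne']
    field_simp
    linear_combination hsq
  have hzw : s + (a : ℝ) * b - 1 = ((2 * a * b - 2 : ℤ) : ℝ) +
      ((s + a * b - 1) / (2 * (a : ℝ) * b - 1 - b))⁻¹ := by
    push_cast at hvw ⊢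
    linear_combination hvw
  refine ⟨?_, fun n ↦ ?_⟩
  · rw [GenContFract.of_h_eq_floor, floor_eq_of_eq_add_inv hw hvw]
    push_cast
    ring
  · rw [partDens_get?_of_period_four hw hx hy hz hvw hwx hxy hyz hzw n]
    push_cast
    rfl
end

section
/- Let a and b be integers with a ≥ 2 and b ≥ 2. Then (x₁, y₁) = (2a²b−1, 2a) is the fundamental solution of the Pell equation x² − (a²b²−b)y² = 1; that is, (2a²b−1)² − (a²b²−b)(2a)² = 1, and every positive integer solution (x, y) satisfies x ≥ 2a²b−1 and y ≥ 2a. -/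
/-- For integers `a ≥ 2` and `b ≥ 2`, the pair `(2a²b − 1, 2a)` is the fundamental solution
of the Pell equation `x² − (a²b² − b)y² = 1`: it is a solution, and every positive integer
solution `(x, y)` satisfies `2a²b − 1 ≤ x` and `2a ≤ y`. -/
theorem pell_fund_sol_a_sq_b_sq_sub_b (a b : ℤ) (ha : 2 ≤ a) (hb : 2 ≤ b) :
    (2 * a ^ 2 * b - 1) ^ 2 - (a ^ 2 * b ^ 2 - b) * (2 * a) ^ 2 = 1 ∧
    ∀ x y : ℤ, 0 < x → 0 < y → x ^ 2 - (a ^ 2 * b ^ 2 - b) * y ^ 2 = 1 →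
      2 * a ^ 2 * b - 1 ≤ x ∧ 2 * a ≤ y := by
  refine ⟨by ring, fun x y hx hy h => ?_⟩
  have hb0 : 0 < b := by linarith
  have ha0 : 0 < a := by linarith
  have hy2 : 1 ≤ y ^ 2 := by nlinarith
  have hby : 1 < b * y ^ 2 := by nlinarith
  have hxlt : x < a * b * y := by
    apply lt_of_pow_lt_pow_left₀ 2 (by positivity)
    nlinarith
  have hy2a : 2 * a ≤ y := by
    by_contra! hlt
    obtain ⟨k, hk⟩ : ∃ k, k = a * b * y - x := ⟨_, rfl⟩
    have hkpos : 0 < k := by linarith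
    obtain rfl : x = a * b * y - k := by linarith
    have hkey : k * (2 * (a * b * y) - k) = b * y ^ 2 - 1 := by linarith
    have hak : k * a < y := by
      have hmul : k * (a * b * y) < k * (2 * (a * b * y) - k) :=
        mul_lt_mul_of_pos_left (by linarith) hkpos
      refine lt_of_mul_lt_mul_right (a := b * y) ?_ (by positivity)
      linarith
    have hk2 : k < 2 := lt_of_mul_lt_mul_right (by linarith) ha0.le
    obtain rfl : k = 1 := by omega
    have hprod : 0 < b * y * (2 * a - y) :=
      mul_pos (mul_pos hb0 hy) (by linarith)
    linarith
  refine ⟨?_, hy2a⟩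
  have hd : 0 ≤ a ^ 2 * b ^ 2 - b := by
    have hab : 1 ≤ a ^ 2 * b := by nlinarith
    nlinarith
  have hsq : (2 * a) ^ 2 ≤ y ^ 2 := pow_le_pow_left₀ (by linarith) hy2a 2
  refine le_of_abs_le (abs_le_of_sq_le_sq ?_ hx.le)
  linarith [mul_le_mul_of_nonneg_left hsq hd]
end

section
/- Let a and b be integers with a ≥ 2 and b ≥ 2. Then the positive integer solutions of x² − (a²b²−b)y² = 1 are exactly the pairs (xₙ, yₙ) = (Vₙ(4a²b−2,−1)/2, 2a·Uₙ(4a²b−2,−1)) for n ≥ 1; that is, a pair of positive integers (x, y) satisfies x² − (a²b²−b)y² = 1 if and only if there exists n ≥ 1 with 2x = Vₙ(4a²b−2,−1) and y = 2a·Uₙ(4a²b−2,−1). -/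
/-- Generalized Fibonacci sequence: `U₀(k,s) = 0`, `U₁(k,s) = 1`,
`U_{n+1}(k,s) = k·Uₙ(k,s) + s·U_{n−1}(k,s)`. -/
def genFib (k s : ℤ) : ℕ → ℤ
  | 0 => 0
  | 1 => 1
  | n + 2 => k * genFib k s (n + 1) + s * genFib k s n

/-- Generalized Lucas sequence: `V₀(k,s) = 2`, `V₁(k,s) = k`,
`V_{n+1}(k,s) = k·Vₙ(k,s) + s·V_{n−1}(k,s)`. -/
def genLucas (k s : ℤ) : ℕ → ℤ
  | 0 => 2
  | 1 => k
  | n + 2 => k * genLucas k s (n + 1) + s * genLucas k s n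

/-- The Pell equation with `d = a²b² − b` has no solution with `0 < y < 2a`. -/
theorem two_mul_le_of_pell {a b x y : ℤ} (ha : 2 ≤ a) (hb : 2 ≤ b) (hx : 0 < x) (hy : 0 < y)
    (h : x ^ 2 - (a ^ 2 * b ^ 2 - b) * y ^ 2 = 1) : 2 * a ≤ y := by
  by_contra! hlt
  obtain ⟨t, rfl⟩ : ∃ t, x = a * b * y - t := ⟨a * b * y - x, by ring⟩
  have key : b * y * (2 * a * t - y) = t ^ 2 - 1 := by linarith
  have hby : 2 ≤ b * y := by nlinarith
  have ht : 0 < t := by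
    by_contra! ht
    have h₁ : 1 ≤ y - 2 * a * t := by nlinarith
    nlinarith [mul_le_mul hby h₁ zero_le_one (by linarith), sq_nonneg t]
  rcases (show t = 1 ∨ 2 ≤ t by lia) with rfl | ht
  · have h₁ : b * y * (2 * a * 1 - y) = 0 := by linarith
    rcases mul_eq_zero.1 h₁ with h₂ | h₂ <;> linarith
  · have h₁ : b * y * (2 * a * (t - 1) + 1) ≤ b * y * (2 * a * t - y) :=
      mul_le_mul_of_nonneg_left (by linarith) (by linarith)
    have h₂ : (t - 1) * (2 * (a * b * y)) < (t - 1) * (t + 1) := by linarith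
    have h₃ := lt_of_mul_lt_mul_left h₂ (by linarith)
    linarith

/-- The fundamental solution `(2a²b − 1, 2a)` of `x² − (a²b² − b)y² = 1`. -/
def pellGenerator (a b : ℤ) : Pell.Solution₁ (a ^ 2 * b ^ 2 - b) :=
  Pell.Solution₁.mk (2 * a ^ 2 * b - 1) (2 * a) (by ring)

theorem isFundamental_pellGenerator {a b : ℤ} (ha : 2 ≤ a) (hb : 2 ≤ b) :
    Pell.IsFundamental (pellGenerator a b) := by
  have hab : 8 ≤ a ^ 2 * b := by nlinarith [mul_le_mul ha ha (by norm_num) (by linarith)]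
  refine ⟨?_, ?_, fun {s} hs => ?_⟩
  · simp only [pellGenerator, Pell.Solution₁.x_mk]; linarith
  · simp only [pellGenerator, Pell.Solution₁.y_mk]; linarith
  · simp only [pellGenerator, Pell.Solution₁.x_mk]
    have hy := two_mul_le_of_pell ha hb (by linarith : 0 < s.x)
      (abs_pos.2 (Pell.Solution₁.y_ne_zero_of_one_lt_x hs)) (by rw [sq_abs]; exact s.prop)
    have hy' : (2 * a) ^ 2 ≤ s.y ^ 2 := by
      rw [← sq_abs s.y]; exact pow_le_pow_left₀ (by linarith) hy 2
    have hd : 0 ≤ a ^ 2 * b ^ 2 - b := by nlinarith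
    have h₁ := mul_le_mul_of_nonneg_left hy' hd
    refine le_of_sq_le_sq ?_ (by linarith)
    rw [s.prop_x]
    linarith

theorem pellGenerator_pow (a b : ℤ) (n : ℕ) :
    2 * (pellGenerator a b ^ n).x = genLucas (4 * a ^ 2 * b - 2) (-1) n ∧
      (pellGenerator a b ^ n).y = 2 * a * genFib (4 * a ^ 2 * b - 2) (-1) n := by
  induction n using Nat.twoStepInduction with
  | zero => simp [genLucas, genFib]
  | one => simp [genLucas, genFib, pellGenerator]; ring
  | more n ih₀ ih₁ =>
    simp only [genLucas, genFib, pow_succ, Pell.Solution₁.x_mul, Pell.Solution₁.y_mul,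
      pellGenerator, Pell.Solution₁.x_mk, Pell.Solution₁.y_mk] at ih₀ ih₁ ⊢
    constructor
    · linear_combination (4 * a ^ 2 * b - 2) * ih₁.1 - ih₀.1
    · linear_combination (4 * a ^ 2 * b - 2) * ih₁.2 - ih₀.2

/-- For integers `a ≥ 2` and `b ≥ 2`, the positive integer solutions of
`x² − (a²b² − b)y² = 1` are exactly the pairs
`(Vₙ(4a²b−2,−1)/2, 2a·Uₙ(4a²b−2,−1))` for `n ≥ 1`. -/
theorem pell_sols_a_sq_b_sq_sub_b (a b : ℤ) (ha : 2 ≤ a) (hb : 2 ≤ b)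
    (x y : ℤ) (hx : 0 < x) (hy : 0 < y) :
    x ^ 2 - (a ^ 2 * b ^ 2 - b) * y ^ 2 = 1 ↔
      ∃ n : ℕ, 1 ≤ n ∧ 2 * x = genLucas (4 * a ^ 2 * b - 2) (-1) n ∧
        y = 2 * a * genFib (4 * a ^ 2 * b - 2) (-1) n := by
  have hf := isFundamental_pellGenerator ha hb
  constructor
  · intro h
    obtain ⟨n, hn⟩ := hf.eq_pow_of_nonneg (a := Pell.Solution₁.mk x y h) hx hy.le
    obtain ⟨h₁, h₂⟩ := pellGenerator_pow a b n
    rw [← hn] at h₁ h₂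
    refine ⟨n, Nat.one_le_iff_ne_zero.2 ?_, h₁, h₂⟩
    rintro rfl
    exact hy.ne' (by simpa [genFib] using h₂)
  · rintro ⟨n, -, h₁, h₂⟩
    obtain ⟨h₃, h₄⟩ := pellGenerator_pow a b n
    obtain rfl : x = (pellGenerator a b ^ n).x := by linarith
    obtain rfl : y = (pellGenerator a b ^ n).y := by rw [h₂, h₄]
    exact Pell.Solution₁.prop _
end

section
/- Let a and b be positive integers with a ≥ 2. Then the Pell equation x² − (a²b²−b)y² = −1 has no positive integer solutions; that is, there are no positive integers x, y with x² − (a²b²−b)y² = −1. -/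
/-- Multiplying a solution of the negative Pell equation for `d = a²b² − b` by the norm one
element `(2a²b − 1) − 2a√d` gives another solution. -/
theorem neg_pell_step {a b x y : ℤ} (h : x ^ 2 - (a ^ 2 * b ^ 2 - b) * y ^ 2 = -1) :
    (x * (2 * a ^ 2 * b - 1) - 2 * a * (a ^ 2 * b ^ 2 - b) * y) ^ 2
      - (a ^ 2 * b ^ 2 - b) * (y * (2 * a ^ 2 * b - 1) - 2 * a * x) ^ 2 = -1 := by
  linear_combination h

/-- For `a ≥ 2`, solutions of the negative Pell equation satisfy `a² < (a²b − 1)y²`. -/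
theorem sq_lt_of_neg_pell {a b x y : ℤ} (ha : 2 ≤ a) (hb : 0 < b) (hx : 0 ≤ x) (hy : 0 < y)
    (h : x ^ 2 - (a ^ 2 * b ^ 2 - b) * y ^ 2 = -1) :
    a ^ 2 < (a ^ 2 * b - 1) * y ^ 2 := by
  have ha2 : 4 ≤ a ^ 2 := by nlinarith
  rcases eq_or_lt_of_le (show 1 ≤ b from hb) with rfl | hb2
  · rcases eq_or_lt_of_le (show 1 ≤ y from hy) with rfl | hy2
    · have h1 : x < a := by nlinarith
      nlinarith
    · have hy4 : 4 ≤ y ^ 2 := by nlinarith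
      nlinarith
  · have hab : a ^ 2 < a ^ 2 * b - 1 := by nlinarith
    have hy1 : 1 ≤ y ^ 2 := by nlinarith
    nlinarith

/-- The step of `neg_pell_step` strictly decreases the second coordinate. -/
theorem abs_neg_pell_step_lt {a b x y : ℤ} (ha : 2 ≤ a) (hb : 0 < b) (hx : 0 ≤ x) (hy : 0 < y)
    (h : x ^ 2 - (a ^ 2 * b ^ 2 - b) * y ^ 2 = -1) :
    |y * (2 * a ^ 2 * b - 1) - 2 * a * x| < y := by
  have hlt := sq_lt_of_neg_pell ha hb hx hy h
  have hby : 0 < b * y ^ 2 := by positivity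
  have upper : x < a * b * y := lt_of_pow_lt_pow_left₀ 2 (by positivity) (by nlinarith)
  have lower : (a ^ 2 * b - 1) * y < a * x :=
    lt_of_pow_lt_pow_left₀ 2 (by positivity) (by linear_combination hlt - a ^ 2 * h)
  rw [abs_lt]
  constructor <;> nlinarith

/-- The negative Pell equation for `d = a²b² − b` with `a ≥ 2` has no solution with positive
second coordinate. -/
theorem neg_pell_ne {a b : ℤ} (ha : 2 ≤ a) (hb : 0 < b) (x y : ℤ) (hy : 0 < y) :
    x ^ 2 - (a ^ 2 * b ^ 2 - b) * y ^ 2 ≠ -1 := by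
  intro h
  rw [← sq_abs x] at h
  have hstep := neg_pell_step h
  have hdec := abs_neg_pell_step_lt ha hb (abs_nonneg x) hy h
  set y' := y * (2 * a ^ 2 * b - 1) - 2 * a * |x|
  have hy' : y' ≠ 0 := by
    intro h0
    rw [h0] at hstep
    nlinarith [sq_nonneg (|x| * (2 * a ^ 2 * b - 1) - 2 * a * (a ^ 2 * b ^ 2 - b) * y)]
  rw [← sq_abs y'] at hstep
  exact neg_pell_ne ha hb _ |y'| (abs_pos.mpr hy') hstep
termination_by y.toNat
decreasing_by exact (Int.toNat_lt_toNat hy).mpr hdec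

/-- For positive integers `a ≥ 2` and `b`, the Pell equation `x² − (a²b² − b)y² = −1`
has no positive integer solutions. -/
theorem pell_neg_one_no_sol_a_sq_b_sq_sub_b (a b : ℤ) (ha : 2 ≤ a) (hb : 0 < b) :
    ¬ ∃ x y : ℤ, 0 < x ∧ 0 < y ∧ x ^ 2 - (a ^ 2 * b ^ 2 - b) * y ^ 2 = -1 := by
  rintro ⟨x, y, -, hy, h⟩
  exact neg_pell_ne ha hb x y hy h
end

section
/- Let k be a positive integer. Then the positive integer solutions of x² − (9k²−3)y² = 1 are exactly the pairs (xₙ, yₙ) = (Vₙ(12k²−2,−1)/2, 2k·Uₙ(12k²−2,−1)) for n ≥ 1; that is, a pair of positive integers (x, y) satisfies x² − (9k²−3)y² = 1 if and only if there exists n ≥ 1 with 2x = Vₙ(12k²−2,−1) and y = 2k·Uₙ(12k²−2,−1). -/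
namespace Pell.Solution₁

variable {d : ℤ} (a : Solution₁ d)

theorem x_pow_add_two (n : ℕ) :
    (a ^ (n + 2)).x = 2 * a.x * (a ^ (n + 1)).x + -1 * (a ^ n).x := by
  simp only [pow_succ, x_mul, y_mul]
  linear_combination (-(a ^ n).x) * a.prop

theorem y_pow_add_two (n : ℕ) :
    (a ^ (n + 2)).y = 2 * a.x * (a ^ (n + 1)).y + -1 * (a ^ n).y := by
  simp only [pow_succ, x_mul, y_mul]
  linear_combination (-(a ^ n).y) * a.prop

/-- The `x`-coordinates of the powers of a Pell solution form half a Lucas sequence. -/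
theorem two_mul_x_pow (n : ℕ) : 2 * (a ^ n).x = genLucas (2 * a.x) (-1) n := by
  induction n using Nat.twoStepInduction with
  | zero => simp [genLucas]
  | one => simp [genLucas]
  | more n h₀ h₁ =>
    rw [genLucas, ← h₀, ← h₁, x_pow_add_two]
    ring

/-- The `y`-coordinates of the powers of a Pell solution are multiples of a Fibonacci sequence. -/
theorem y_pow (n : ℕ) : (a ^ n).y = a.y * genFib (2 * a.x) (-1) n := by
  induction n using Nat.twoStepInduction with
  | zero => simp [genFib]
  | one => simp [genFib]
  | more n h₀ h₁ =>
    rw [genFib, y_pow_add_two, h₀, h₁]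
    ring

end Pell.Solution₁

theorem two_mul_le_of_pell_nine_k_sq_sub_three {k x y : ℤ} (hk : 0 < k) (hx : 0 < x) (hy : 0 < y)
    (h : x ^ 2 - (9 * k ^ 2 - 3) * y ^ 2 = 1) : 2 * k ≤ y := by
  by_contra! hlt
  obtain ⟨t, ht⟩ : ∃ t, t = 3 * k * y - x := ⟨_, rfl⟩
  have ht_pos : 0 < t := by
    by_contra! hle
    nlinarith [mul_pos hk hy]
  have key : 3 * y * (2 * k * t - y) = t ^ 2 - 1 := by
    subst ht
    linear_combination -h
  have hky : 0 < k * y := mul_pos hk hy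
  obtain rfl | ht_one : t = 1 ∨ 1 < t := by omega
  · have : 0 < 3 * y * (2 * k * 1 - y) := by
      apply mul_pos <;> linarith
    linarith
  · have h₁ : 3 * y * (2 * k * (t - 1)) < 3 * y * (2 * k * t - y) := by
      apply mul_lt_mul_of_pos_left <;> linarith
    have h₂ : (t - 1) * (6 * (k * y)) < (t - 1) * (t + 1) := by linarith
    have h₃ : 6 * (k * y) < t + 1 := lt_of_mul_lt_mul_left h₂ (by linarith)
    linarith

/-- The solution `(6k² − 1, 2k)` of `x² − (9k² − 3)y² = 1`. -/
def pellSolNineKSqSubThree (k : ℤ) : Pell.Solution₁ (9 * k ^ 2 - 3) :=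
  Pell.Solution₁.mk (6 * k ^ 2 - 1) (2 * k) (by ring)

theorem isFundamental_pellSolNineKSqSubThree {k : ℤ} (hk : 0 < k) :
    Pell.IsFundamental (pellSolNineKSqSubThree k) := by
  simp only [Pell.IsFundamental, pellSolNineKSqSubThree, Pell.Solution₁.x_mk,
    Pell.Solution₁.y_mk]
  refine ⟨by nlinarith, by linarith, fun {b} hb ↦ ?_⟩
  have hb₀ : 0 < b.x := by linarith
  have hy : 2 * k ≤ |b.y| := by
    refine two_mul_le_of_pell_nine_k_sq_sub_three hk hb₀
      (abs_pos.mpr (Pell.Solution₁.y_ne_zero_of_one_lt_x hb)) ?_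
    rw [sq_abs]
    exact b.prop
  have hy_sq : (2 * k) ^ 2 ≤ b.y ^ 2 := by
    rw [← sq_abs b.y]
    exact pow_le_pow_left₀ (by linarith) hy 2
  refine abs_le_of_sq_le_sq' ?_ hb₀.le |>.2
  rw [b.prop_x]
  have hd : 0 ≤ 9 * k ^ 2 - 3 := by nlinarith
  linarith [mul_le_mul_of_nonneg_left hy_sq hd]

/-- For a positive integer `k`, the positive integer solutions of `x² − (9k² − 3)y² = 1`
are exactly the pairs `(Vₙ(12k²−2,−1)/2, 2k·Uₙ(12k²−2,−1))` for `n ≥ 1`. -/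
theorem pell_sols_nine_k_sq_sub_three (k : ℤ) (hk : 0 < k)
    (x y : ℤ) (hx : 0 < x) (hy : 0 < y) :
    x ^ 2 - (9 * k ^ 2 - 3) * y ^ 2 = 1 ↔
      ∃ n : ℕ, 1 ≤ n ∧ 2 * x = genLucas (12 * k ^ 2 - 2) (-1) n ∧
        y = 2 * k * genFib (12 * k ^ 2 - 2) (-1) n := by
  set a := pellSolNineKSqSubThree k with ha
  have hax : 2 * a.x = 12 * k ^ 2 - 2 := by
    simp only [ha, pellSolNineKSqSubThree, Pell.Solution₁.x_mk]
    ring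
  have hay : a.y = 2 * k := by simp [ha, pellSolNineKSqSubThree]
  simp only [← hax, ← hay, ← Pell.Solution₁.two_mul_x_pow, ← Pell.Solution₁.y_pow]
  constructor
  · intro h
    obtain ⟨n, hn⟩ := (isFundamental_pellSolNineKSqSubThree hk).eq_pow_of_nonneg
      (a := Pell.Solution₁.mk x y h) (by simpa using hx) (by simpa using hy.le)
    rw [← ha] at hn
    refine ⟨n, Nat.one_le_iff_ne_zero.mpr ?_, by simp [← hn], by simp [← hn]⟩
    rintro rfl
    have := congrArg Pell.Solution₁.y hn
    simp only [Pell.Solution₁.y_mk, pow_zero, Pell.Solution₁.y_one] at this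
    exact hy.ne' this
  · rintro ⟨n, -, hxn, rfl⟩
    rw [mul_left_cancel₀ two_ne_zero hxn]
    exact (a ^ n).prop
end

section
/- Let k be a positive integer. Then the positive integer solutions of x² − (9k²−3)y² = 4 are exactly the pairs (xₙ, yₙ) = (Vₙ(12k²−2,−1), 4k·Uₙ(12k²−2,−1)) for n ≥ 1; that is, a pair of positive integers (x, y) satisfies x² − (9k²−3)y² = 4 if and only if there exists n ≥ 1 with x = Vₙ(12k²−2,−1) and y = 4k·Uₙ(12k²−2,−1). -/
/-- Multiplication by `a + √(a² − 1)`, expressed in the sequences with parameters `(2a, −1)`. -/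
theorem genLucas_genFib_succ (a : ℤ) (n : ℕ) :
    genLucas (2 * a) (-1) (n + 1) =
        a * genLucas (2 * a) (-1) n + 2 * (a ^ 2 - 1) * genFib (2 * a) (-1) n ∧
      2 * genFib (2 * a) (-1) (n + 1) =
        2 * a * genFib (2 * a) (-1) n + genLucas (2 * a) (-1) n := by
  induction n with
  | zero => simp [genLucas, genFib, mul_comm]
  | succ n ih =>
    obtain ⟨hV, hU⟩ := ih
    rw [genLucas, genFib]
    constructor
    · linear_combination a * hV - (a ^ 2 - 1) * hU
    · linear_combination a * hU - hV

theorem genLucas_sq_sub_genFib_sq (a : ℤ) (n : ℕ) :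
    genLucas (2 * a) (-1) n ^ 2 - 4 * (a ^ 2 - 1) * genFib (2 * a) (-1) n ^ 2 = 4 := by
  induction n with
  | zero => simp [genLucas, genFib]
  | succ n ih =>
    obtain ⟨hV, hU⟩ := genLucas_genFib_succ a n
    have hU2 : 4 * genFib (2 * a) (-1) (n + 1) ^ 2 =
        (2 * a * genFib (2 * a) (-1) n + genLucas (2 * a) (-1) n) ^ 2 := by
      rw [← hU]; ring
    rw [hV]
    linear_combination ih - (a ^ 2 - 1) * hU2

/-- A positive solution of `x² − (9k² − 3)y² = 4` has `y ≥ 4k`. -/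
theorem four_mul_le_of_pell_four {k x y : ℤ} (hk : 0 < k) (hx : 0 < x) (hy : 0 < y)
    (h : x ^ 2 - (9 * k ^ 2 - 3) * y ^ 2 = 4) : 4 * k ≤ y := by
  have hky : 0 < k * y := mul_pos hk hy
  obtain rfl | hy2 : y = 1 ∨ 2 ≤ y := by omega
  · have h1 : 3 * k < x := by nlinarith
    have h2 : x < 3 * k + 1 := by nlinarith
    omega
  obtain ⟨t, rfl⟩ : ∃ t, x = 3 * (k * y) - t := ⟨3 * (k * y) - x, by ring⟩
  have ht : t * (6 * (k * y) - t) = 3 * y ^ 2 - 4 := by linear_combination -h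
  have ht0 : 0 < t := by
    by_contra! hle
    nlinarith
  obtain rfl | ht2 : t = 1 ∨ 2 ≤ t := by omega
  · have h1 : y * (y - 2 * k) = 1 := by linarith
    have := Int.eq_one_or_neg_one_of_mul_eq_one h1
    omega
  · have h1 : 4 * (k * y) ≤ y * y := by
      nlinarith [mul_nonneg (sub_nonneg.2 ht2) (show 0 ≤ 6 * (k * y) - t - 2 by nlinarith)]
    nlinarith

theorem exists_genLucas_genFib_of_pell_four {k : ℤ} (hk : 0 < k) (m : ℕ) :
    ∀ x y : ℤ, 0 < x → 0 ≤ y → y.toNat = m → x ^ 2 - (9 * k ^ 2 - 3) * y ^ 2 = 4 →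
      ∃ n : ℕ, x = genLucas (2 * (6 * k ^ 2 - 1)) (-1) n ∧
        y = 4 * k * genFib (2 * (6 * k ^ 2 - 1)) (-1) n := by
  induction m using Nat.strong_induction_on with
  | _ m ih =>
    intro x y hx hy hm h
    obtain rfl | hy0 := hy.eq_or_lt
    · refine ⟨0, ?_, by simp [genFib]⟩
      simp only [genLucas]
      nlinarith
    have hle := four_mul_le_of_pell_four hk hx hy0 h
    have hk1 : 1 ≤ k ^ 2 := one_le_pow₀ hk
    have hD : 0 < 9 * k ^ 2 - 3 := by linarith
    have hx' : 0 < (6 * k ^ 2 - 1) * x - 2 * k * (9 * k ^ 2 - 3) * y := by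
      refine sub_pos.2 (lt_of_pow_lt_pow_left₀ 2 (by nlinarith) ?_)
      have e : ((6 * k ^ 2 - 1) * x) ^ 2 - (2 * k * (9 * k ^ 2 - 3) * y) ^ 2 =
          x ^ 2 + 16 * (k ^ 2 * (9 * k ^ 2 - 3)) := by
        linear_combination (4 * k ^ 2 * (9 * k ^ 2 - 3)) * h
      have : 0 < k ^ 2 * (9 * k ^ 2 - 3) := by positivity
      have : 0 < x ^ 2 := by positivity
      linarith
    have hy' : 0 ≤ (6 * k ^ 2 - 1) * y - 2 * k * x := by
      refine sub_nonneg.2 (le_of_sq_le_sq ?_ (by nlinarith))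
      have e : ((6 * k ^ 2 - 1) * y) ^ 2 - (2 * k * x) ^ 2 = y ^ 2 - (4 * k) ^ 2 := by
        linear_combination (-4 * k ^ 2) * h
      have : (4 * k) ^ 2 ≤ y ^ 2 := by gcongr
      linarith
    have hlt : (6 * k ^ 2 - 1) * y - 2 * k * x < y := by
      suffices (6 * k ^ 2 - 2) * y < 2 * k * x by linarith
      refine lt_of_pow_lt_pow_left₀ 2 (by positivity) ?_
      have e : (2 * k * x) ^ 2 - ((6 * k ^ 2 - 2) * y) ^ 2 =
          4 * (3 * k ^ 2 - 1) * y ^ 2 + 16 * k ^ 2 := by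
        linear_combination (4 * k ^ 2) * h
      have : 0 ≤ (3 * k ^ 2 - 1) * y ^ 2 := mul_nonneg (by linarith) (sq_nonneg y)
      linarith
    obtain ⟨n, hV, hU⟩ := ih _ (by omega) _ _ hx' hy' rfl (by linear_combination h)
    obtain ⟨hV1, hU1⟩ := genLucas_genFib_succ (6 * k ^ 2 - 1) n
    refine ⟨n + 1, ?_, ?_⟩
    · rw [hV1, ← hV]
      linear_combination (2 * k * (9 * k ^ 2 - 3)) * hU
    · linear_combination (6 * k ^ 2 - 1) * hU + 2 * k * hV - 2 * k * hU1

/-- For a positive integer `k`, the positive integer solutions of `x² − (9k² − 3)y² = 4`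
are exactly the pairs `(Vₙ(12k²−2,−1), 4k·Uₙ(12k²−2,−1))` for `n ≥ 1`. -/
theorem pell_four_sols_nine_k_sq_sub_three (k : ℤ) (hk : 0 < k)
    (x y : ℤ) (hx : 0 < x) (hy : 0 < y) :
    x ^ 2 - (9 * k ^ 2 - 3) * y ^ 2 = 4 ↔
      ∃ n : ℕ, 1 ≤ n ∧ x = genLucas (12 * k ^ 2 - 2) (-1) n ∧
        y = 4 * k * genFib (12 * k ^ 2 - 2) (-1) n := by
  have ha : 12 * k ^ 2 - 2 = 2 * (6 * k ^ 2 - 1) := by ring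
  rw [ha]
  constructor
  · intro h
    obtain ⟨n, hV, hU⟩ := exists_genLucas_genFib_of_pell_four hk _ x y hx hy.le rfl h
    refine ⟨n, Nat.one_le_iff_ne_zero.2 ?_, hV, hU⟩
    rintro rfl
    simp [genFib] at hU
    omega
  · rintro ⟨n, -, rfl, rfl⟩
    linear_combination genLucas_sq_sub_genFib_sq (6 * k ^ 2 - 1) n
end

section
/- Let a and b be positive integers with a ≥ 3. Then the simple continued fraction expansion of √(a²b²−2b) is [ab−1; 1, a−2, 1, 2ab−2] with period (1, a−2, 1, 2ab−2); that is, the sequence of partial quotients of √(a²b²−2b) is a₀ = ab−1 followed by the periodic repetition of the block (1, a−2, 1, 2ab−2). -/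
namespace GenContFract

/-- If `x = m + 1 / y` with `y > 1`, then `m` is the integer part of `x` and `y` is the next
complete quotient. -/
theorem floor_and_inv_fract_of_eq_add_inv {x y : ℝ} {m : ℤ} (hy : 1 < y) (hx : x = m + y⁻¹) :
    ⌊x⌋ = m ∧ (Int.fract x)⁻¹ = y := by
  have hfloor : ⌊x⌋ = m := by
    have h0 : 0 < y⁻¹ := by positivity
    have h1 : y⁻¹ < 1 := inv_lt_one_of_one_lt₀ hy
    rw [Int.floor_eq_iff]
    constructor <;> linarith
  refine ⟨hfloor, ?_⟩
  rw [Int.fract, hfloor, hx, add_sub_cancel_left, inv_inv]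

/-- The partial denominators of `x = m + 1 / y` are the integer part of `y` followed by the partial
denominators of `y`. -/
theorem partDens_of_eq_add_inv {x y : ℝ} {m k : ℤ} (hy : 1 < y) (hx : x = m + y⁻¹)
    (hk : ⌊y⌋ = k) :
    (GenContFract.of x).partDens.get? 0 = some (k : ℝ) ∧
      ∀ n, (GenContFract.of x).partDens.get? (n + 1) = (GenContFract.of y).partDens.get? n := by
  obtain ⟨-, hfr⟩ := floor_and_inv_fract_of_eq_add_inv hy hx
  have hne : Int.fract x ≠ 0 := by
    intro h
    rw [h, inv_zero] at hfr
    linarith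
  constructor
  · have h := of_s_head hne
    rw [hfr, hk] at h
    rw [partDens, Stream'.Seq.map_get?]
    change Option.map Pair.b (GenContFract.of x).s.head = _
    rw [h]
    rfl
  · intro n
    rw [partDens, partDens, Stream'.Seq.map_get?, Stream'.Seq.map_get?, of_s_succ, hfr]

end GenContFract

open GenContFract

/-- For positive integers `a ≥ 3` and `b`, the simple continued fraction expansion of
`√(a²b² − 2b)` is `[ab−1; 1, a−2, 1, 2ab−2]` with periodic block `(1, a−2, 1, 2ab−2)`:
the integer part is `ab − 1` and the `n`-th partial denominator cycles through this block. -/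
theorem cf_sqrt_a_sq_b_sq_sub_two_b (a b : ℤ) (ha : 3 ≤ a) (hb : 0 < b) :
    (GenContFract.of (Real.sqrt ((a : ℝ) ^ 2 * (b : ℝ) ^ 2 - 2 * b))).h = (a : ℝ) * b - 1 ∧
    ∀ n : ℕ, (GenContFract.of (Real.sqrt ((a : ℝ) ^ 2 * (b : ℝ) ^ 2 - 2 * b))).partDens.get? n =
      some (if n % 4 = 0 then (1 : ℝ)
            else if n % 4 = 1 then ((a : ℝ) - 2)
            else if n % 4 = 2 then (1 : ℝ)
            else (2 * a * b - 2 : ℝ)) := by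
  have ha' : (3 : ℝ) ≤ a := by exact_mod_cast ha
  have hb' : (1 : ℝ) ≤ b := by exact_mod_cast hb
  set s := Real.sqrt ((a : ℝ) ^ 2 * (b : ℝ) ^ 2 - 2 * b) with hs
  have hab : 3 * (b : ℝ) ≤ a * b := by nlinarith
  have hsq : s ^ 2 = (a : ℝ) ^ 2 * (b : ℝ) ^ 2 - 2 * b := Real.sq_sqrt (by nlinarith)
  have hlo : (a : ℝ) * b - 1 < s := Real.lt_sqrt_of_sq_lt (by nlinarith)
  have hhi : s < a * b := by
    rw [hs, Real.sqrt_lt' (by linarith)]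
    nlinarith
  have hq : (0 : ℝ) < 2 * (a * b) - 2 * b - 1 := by linarith
  have h2b : (0 : ℝ) < 2 * b := by linarith
  have hy₁ : 1 < (s + a * b - 1) / (2 * (a * b) - 2 * b - 1) := by
    rw [one_lt_div hq]; linarith
  have hy₂ : 1 < (s + a * b - 2 * b) / (2 * b) := by
    rw [one_lt_div h2b]; linarith
  have hy₃ : 1 < (s + a * b - 2 * b) / (2 * (a * b) - 2 * b - 1) := by
    rw [one_lt_div hq]; linarith
  have hy₄ : 1 < s + a * b - 1 := by linarith
  have e₀ : s = ((a * b - 1 : ℤ) : ℝ) + ((s + a * b - 1) / (2 * (a * b) - 2 * b - 1))⁻¹ := by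
    have : s + a * b - 1 ≠ 0 := by linarith
    push_cast
    field_simp
    linear_combination hsq
  have e₁ : (s + a * b - 1) / (2 * (a * b) - 2 * b - 1) =
      ((1 : ℤ) : ℝ) + ((s + a * b - 2 * b) / (2 * b))⁻¹ := by
    have : s + a * b - 2 * b ≠ 0 := by linarith
    push_cast
    rw [inv_div, div_eq_iff hq.ne', add_mul, div_mul_eq_mul_div, ← sub_eq_iff_eq_add',
      eq_div_iff this]
    linear_combination hsq
  have e₂ : (s + a * b - 2 * b) / (2 * b) =
      ((a - 2 : ℤ) : ℝ) + ((s + a * b - 2 * b) / (2 * (a * b) - 2 * b - 1))⁻¹ := by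
    have : s + a * b - 2 * b ≠ 0 := by linarith
    push_cast
    rw [inv_div, div_eq_iff h2b.ne', add_mul, div_mul_eq_mul_div, ← sub_eq_iff_eq_add',
      eq_div_iff this]
    linear_combination hsq
  have e₃ : (s + a * b - 2 * b) / (2 * (a * b) - 2 * b - 1) =
      ((1 : ℤ) : ℝ) + (s + a * b - 1)⁻¹ := by
    have : s + a * b - 1 ≠ 0 := by linarith
    push_cast
    rw [div_eq_iff hq.ne', ← sub_eq_zero]
    field_simp
    linear_combination hsq
  have e₄ : s + a * b - 1 = ((2 * a * b - 2 : ℤ) : ℝ) +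
      ((s + a * b - 1) / (2 * (a * b) - 2 * b - 1))⁻¹ := by
    push_cast at e₀ ⊢
    linear_combination e₀
  have f₁ := (floor_and_inv_fract_of_eq_add_inv hy₂ e₁).1
  have f₂ := (floor_and_inv_fract_of_eq_add_inv hy₃ e₂).1
  have f₃ := (floor_and_inv_fract_of_eq_add_inv hy₄ e₃).1
  have f₄ := (floor_and_inv_fract_of_eq_add_inv hy₁ e₄).1
  obtain ⟨d₀, t₀⟩ := partDens_of_eq_add_inv hy₁ e₀ f₁
  obtain ⟨d₁, t₁⟩ := partDens_of_eq_add_inv hy₂ e₁ f₂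
  obtain ⟨d₂, t₂⟩ := partDens_of_eq_add_inv hy₃ e₂ f₃
  obtain ⟨d₃, t₃⟩ := partDens_of_eq_add_inv hy₄ e₃ f₄
  obtain ⟨d₄, t₄⟩ := partDens_of_eq_add_inv hy₁ e₄ f₁
  have hper : ∀ n, (GenContFract.of (s + a * b - 1)).partDens.get? n = (GenContFract.of s).partDens.get? n := by
    rintro (_ | n)
    · rw [d₄, d₀]
    · rw [t₄, t₀]
  refine ⟨?_, fun n => ?_⟩
  · rw [of_h_eq_floor, (floor_and_inv_fract_of_eq_add_inv hy₁ e₀).1]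
    push_cast
    rfl
  · induction n using Nat.strong_induction_on with
    | _ n ih =>
      match n with
      | 0 => simp [d₀]
      | 1 => simp [t₀, d₁]
      | 2 => simp [t₀, t₁, d₂]
      | 3 => simp [t₀, t₁, t₂, d₃]
      | n + 4 =>
        rw [t₀, t₁, t₂, t₃, hper, ih n (by omega), Nat.add_mod_right]
end

section
/- Let a and b be positive integers with a ≥ 3. Then (x₁, y₁) = (a²b−1, a) is the fundamental solution of the Pell equation x² − (a²b²−2b)y² = 1; that is, (a²b−1)² − (a²b²−2b)·a² = 1, and every positive integer solution (x, y) satisfies x ≥ a²b−1 and y ≥ a. -/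
/-- For positive integers `a ≥ 3` and `b`, the pair `(a²b − 1, a)` is the fundamental
solution of the Pell equation `x² − (a²b² − 2b)y² = 1`: it is a solution, and every
positive integer solution `(x, y)` satisfies `a²b − 1 ≤ x` and `a ≤ y`. -/
theorem pell_fund_sol_a_sq_b_sq_sub_two_b (a b : ℤ) (ha : 3 ≤ a) (hb : 0 < b) :
    (a ^ 2 * b - 1) ^ 2 - (a ^ 2 * b ^ 2 - 2 * b) * a ^ 2 = 1 ∧
    ∀ x y : ℤ, 0 < x → 0 < y → x ^ 2 - (a ^ 2 * b ^ 2 - 2 * b) * y ^ 2 = 1 →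
      a ^ 2 * b - 1 ≤ x ∧ a ≤ y := by
  refine ⟨by ring, fun x y hx hy h => ?_⟩
  have hby : 0 < b * y := mul_pos hb hy
  have hby2 : 0 < b * y * y := mul_pos hby hy
  have hlt : x < a * (b * y) := by
    refine lt_of_pow_lt_pow_left₀ 2 (by positivity) ?_
    linarith [show (a * (b * y)) ^ 2 - x ^ 2
      = 2 * (b * y * y) - (x ^ 2 - (a ^ 2 * b ^ 2 - 2 * b) * y ^ 2) by ring]
  have hay : a ≤ y := by
    have hprod : 0 ≤ (a * (b * y) - x - 1) * (a * (b * y) + x - 1) :=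
      mul_nonneg (by linarith) (by linarith)
    refine le_of_mul_le_mul_left ?_ hby
    linarith [show (a * (b * y) - x - 1) * (a * (b * y) + x - 1)
      = 2 * (b * y * y) - 2 * (b * y * a) + 1
        - (x ^ 2 - (a ^ 2 * b ^ 2 - 2 * b) * y ^ 2) by ring]
  refine ⟨?_, hay⟩
  have hd : 0 ≤ a ^ 2 * b ^ 2 - 2 * b := by
    have hab : 2 ≤ a ^ 2 * b := by nlinarith
    nlinarith
  refine le_of_abs_le (abs_le_of_sq_le_sq ?_ hx.le)
  have hy2 : a ^ 2 ≤ y ^ 2 := pow_le_pow_left₀ (by linarith) hay 2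
  linarith [mul_le_mul_of_nonneg_left hy2 hd,
    show (a ^ 2 * b - 1) ^ 2 - (a ^ 2 * b ^ 2 - 2 * b) * a ^ 2 = 1 by ring]
end

section
/- Let a and b be positive integers with a ≥ 3. Then the positive integer solutions of x² − (a²b²−2b)y² = 1 are exactly the pairs (xₙ, yₙ) = (Vₙ(2a²b−2,−1)/2, a·Uₙ(2a²b−2,−1)) for n ≥ 1; that is, a pair of positive integers (x, y) satisfies x² − (a²b²−2b)y² = 1 if and only if there exists n ≥ 1 with 2x = Vₙ(2a²b−2,−1) and y = a·Uₙ(2a²b−2,−1). -/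
open Pell in
/-- The powers of a solution of Pell's equation, in terms of Lucas sequences. -/
theorem two_mul_x_pow_and_y_pow {d : ℤ} (z : Solution₁ d) (n : ℕ) :
    2 * (z ^ n).x = genLucas (2 * z.x) (-1) n ∧
      (z ^ n).y = z.y * genFib (2 * z.x) (-1) n := by
  induction n using Nat.twoStepInduction with
  | zero => simp [genLucas, genFib]
  | one => simp [genLucas, genFib]
  | more n ih₀ ih₁ =>
    have hx : (z ^ (n + 2)).x = 2 * z.x * (z ^ (n + 1)).x - (z ^ n).x := by
      simp only [pow_succ, Solution₁.x_mul, Solution₁.y_mul]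
      linear_combination (-(z ^ n).x) * z.prop
    have hy : (z ^ (n + 2)).y = 2 * z.x * (z ^ (n + 1)).y - (z ^ n).y := by
      simp only [pow_succ, Solution₁.x_mul, Solution₁.y_mul]
      linear_combination (-(z ^ n).y) * z.prop
    rw [hx, hy, genLucas, genFib, ← ih₀.1, ← ih₁.1]
    exact ⟨by ring, by rw [ih₀.2, ih₁.2]; ring⟩

/-- A positive solution of `x² − (a²b² − 2b)y² = 1` has `y ≥ a`. -/
theorem le_of_sq_sub_eq_one {a b x y : ℤ} (ha : 0 < a) (hb : 0 < b) (hx : 0 < x) (hy : 0 < y)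
    (h : x ^ 2 - (a ^ 2 * b ^ 2 - 2 * b) * y ^ 2 = 1) : a ≤ y := by
  have hby : 0 < b * y := by positivity
  have hlt : x < a * b * y := by
    refine lt_of_pow_lt_pow_left₀ 2 (by positivity) ?_
    nlinarith [mul_pos hby hy]
  have hsq : x ^ 2 ≤ (a * b * y - 1) ^ 2 := pow_le_pow_left₀ hx.le (by linarith) 2
  refine le_of_mul_le_mul_left ?_ hby
  nlinarith

open Pell in
/-- The solution `(a²b − 1, a)` of `x² − (a²b² − 2b)y² = 1`. -/
def basicSolution (a b : ℤ) : Solution₁ (a ^ 2 * b ^ 2 - 2 * b) :=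
  Solution₁.mk (a ^ 2 * b - 1) a (by ring)

open Pell in
theorem isFundamental_basicSolution {a b : ℤ} (ha : 3 ≤ a) (hb : 0 < b) :
    IsFundamental (basicSolution a b) := by
  have hab : 9 ≤ a ^ 2 * b := by nlinarith [mul_pos hb (by linarith : 0 < a)]
  refine ⟨?_, ?_, ?_⟩
  · simp only [basicSolution, Solution₁.x_mk]
    linarith
  · simp only [basicSolution, Solution₁.y_mk]
    linarith
  · intro z hz
    have hy : a ≤ |z.y| :=
      le_of_sq_sub_eq_one (by linarith) hb (by linarith)
        (abs_pos.mpr (Solution₁.y_ne_zero_of_one_lt_x hz)) (by rw [sq_abs]; exact z.prop)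
    have hsq : a ^ 2 ≤ z.y ^ 2 := by
      rw [← sq_abs z.y]
      exact pow_le_pow_left₀ (by linarith) hy 2
    have hd : 0 ≤ a ^ 2 * b ^ 2 - 2 * b := by nlinarith
    refine (pow_le_pow_iff_left₀ ?_ (by linarith) two_ne_zero).mp ?_
    · simp only [basicSolution, Solution₁.x_mk]
      linarith
    rw [Solution₁.prop_x, Solution₁.prop_x]
    simp only [basicSolution, Solution₁.y_mk]
    gcongr

/-- For positive integers `a ≥ 3` and `b`, the positive integer solutions of
`x² − (a²b² − 2b)y² = 1` are exactly the pairs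
`(Vₙ(2a²b−2,−1)/2, a·Uₙ(2a²b−2,−1))` for `n ≥ 1`. -/
theorem pell_sols_a_sq_b_sq_sub_two_b (a b : ℤ) (ha : 3 ≤ a) (hb : 0 < b)
    (x y : ℤ) (hx : 0 < x) (hy : 0 < y) :
    x ^ 2 - (a ^ 2 * b ^ 2 - 2 * b) * y ^ 2 = 1 ↔
      ∃ n : ℕ, 1 ≤ n ∧ 2 * x = genLucas (2 * a ^ 2 * b - 2) (-1) n ∧
        y = a * genFib (2 * a ^ 2 * b - 2) (-1) n := by
  have hz := isFundamental_basicSolution ha hb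
  have hk : 2 * (basicSolution a b).x = 2 * a ^ 2 * b - 2 := by
    simp only [basicSolution, Pell.Solution₁.x_mk]
    ring
  have hpow := two_mul_x_pow_and_y_pow (basicSolution a b)
  rw [hk] at hpow
  constructor
  · intro h
    obtain ⟨n, hn⟩ := hz.eq_pow_of_nonneg (a := Pell.Solution₁.mk x y h) hx hy.le
    have hxn : x = (basicSolution a b ^ n).x := by rw [← hn, Pell.Solution₁.x_mk]
    have hyn : y = (basicSolution a b ^ n).y := by rw [← hn, Pell.Solution₁.y_mk]
    refine ⟨n, Nat.one_le_iff_ne_zero.mpr ?_, hxn ▸ (hpow n).1, hyn.trans (hpow n).2⟩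
    rintro rfl
    rw [pow_zero, Pell.Solution₁.y_one] at hyn
    exact hy.ne' hyn
  · rintro ⟨n, -, hxn, hyn⟩
    have hx' : x = (basicSolution a b ^ n).x := by linarith [(hpow n).1]
    have hy' : y = (basicSolution a b ^ n).y := hyn.trans (hpow n).2.symm
    rw [hx', hy']
    exact (basicSolution a b ^ n).prop
end

section
/- Let a and b be positive integers with a ≥ 3. Then the Pell equation x² − (a²b²−2b)y² = −1 has no positive integer solutions; that is, there are no positive integers x, y with x² − (a²b²−2b)y² = −1. -/
/-- Multiplying a solution of the negative Pell equation by the inverse of the unit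
`(a²b − 1) + a√d` gives a solution with strictly smaller positive `y`. -/
lemma neg_pell_descent {a b x y : ℤ} (ha : 3 ≤ a) (hb : 0 < b) (hx : 0 ≤ x) (hy : 0 < y)
    (h : x ^ 2 - (a ^ 2 * b ^ 2 - 2 * b) * y ^ 2 = -1) :
    ∃ x' y' : ℤ, 0 ≤ x' ∧ 0 < y' ∧ y' < y ∧
      x' ^ 2 - (a ^ 2 * b ^ 2 - 2 * b) * y' ^ 2 = -1 := by
  have hab : a ^ 2 ≤ a ^ 2 * b := le_mul_of_one_le_right (sq_nonneg a) hb
  have ha2 : 9 ≤ a ^ 2 := by nlinarith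
  have hy2 : 1 ≤ y ^ 2 := one_le_pow₀ hy
  have hpos : a * x < (a ^ 2 * b - 1) * y := by
    refine lt_of_pow_lt_pow_left₀ 2 (mul_nonneg (by linarith) hy.le) ?_
    have key : ((a ^ 2 * b - 1) * y) ^ 2 = (a * x) ^ 2 + y ^ 2 + a ^ 2 := by
      linear_combination -a ^ 2 * h
    linarith
  have hlt : (a ^ 2 * b - 2) * y < a * x := by
    refine lt_of_pow_lt_pow_left₀ 2 (mul_nonneg (by linarith) hx) ?_
    have key : (a * x) ^ 2 = ((a ^ 2 * b - 2) * y) ^ 2 + (2 * (a ^ 2 * b) - 4) * y ^ 2 - a ^ 2 := by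
      linear_combination a ^ 2 * h
    have : 2 * (a ^ 2 * b) - 4 ≤ (2 * (a ^ 2 * b) - 4) * y ^ 2 :=
      le_mul_of_one_le_right (by linarith) hy2
    linarith
  refine ⟨|(a ^ 2 * b - 1) * x - (a ^ 2 * b ^ 2 - 2 * b) * a * y|,
    (a ^ 2 * b - 1) * y - a * x, abs_nonneg _, by linarith, by linarith, ?_⟩
  rw [sq_abs]
  linear_combination h

/-- For positive integers `a ≥ 3` and `b`, the Pell equation `x² − (a²b² − 2b)y² = −1`
has no positive integer solutions. -/
theorem pell_neg_one_no_sol_a_sq_b_sq_sub_two_b (a b : ℤ) (ha : 3 ≤ a) (hb : 0 < b) :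
    ¬ ∃ x y : ℤ, 0 < x ∧ 0 < y ∧ x ^ 2 - (a ^ 2 * b ^ 2 - 2 * b) * y ^ 2 = -1 := by
  rintro ⟨x, y, hx, hy, h⟩
  have no_sol : ∀ n : ℕ, ∀ x y : ℤ, y.toNat = n → 0 ≤ x → 0 < y →
      x ^ 2 - (a ^ 2 * b ^ 2 - 2 * b) * y ^ 2 ≠ -1 := by
    intro n
    induction n using Nat.strong_induction_on with
    | _ n ih =>
      intro x y hn hx hy h
      obtain ⟨x', y', hx', hy', hlt, h'⟩ := neg_pell_descent ha hb hx hy h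
      exact ih y'.toNat (by omega) x' y' rfl hx' hy' h'
  exact no_sol _ x y rfl hx.le hy h
end

section
/- Let a and b be positive integers with a ≥ 3. Then the Pell equation x² − (a²b²−2b)y² = −4 has no positive integer solutions; that is, there are no positive integers x, y with x² − (a²b²−2b)y² = −4. -/
/-- With `d = a²b² − 2b`, the number `d - 4` is not a perfect square. -/
theorem sq_ne_a_sq_b_sq_sub_two_b_sub_four {a b : ℤ} (ha : 3 ≤ a) (hb : 0 < b) (x : ℤ)
    (hx : 0 ≤ x) : x ^ 2 ≠ a ^ 2 * b ^ 2 - 2 * b - 4 := by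
  intro h
  have hlt : x < a * b := by
    refine lt_of_pow_lt_pow_left₀ 2 (by positivity) ?_
    nlinarith
  by_cases hab : 3 ≤ b * (a - 1)
  · have hgt : a * b - 1 < x := by
      refine lt_of_pow_lt_pow_left₀ 2 hx ?_
      nlinarith
    omega
  · obtain rfl : b = 1 := by nlinarith
    obtain rfl : a = 3 := by omega
    have : x < 3 := by omega
    interval_cases x <;> omega

/-- Multiplication by the inverse of the unit `(a²b − 1) + a√d` of norm one, where
`d = a²b² − 2b`, strictly decreases the second coordinate of a solution of
`x² − d y² = −4` with `y ≥ 2`. -/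
theorem abs_lt_of_pell_neg_four {a b x y : ℤ} (ha : 3 ≤ a) (hb : 0 < b) (hx : 0 ≤ x)
    (hy : 2 ≤ y) (h : x ^ 2 - (a ^ 2 * b ^ 2 - 2 * b) * y ^ 2 = -4) :
    |a * x - (a ^ 2 * b - 1) * y| < y := by
  have ha0 : 0 < a := by omega
  have hy0 : 0 < y := by omega
  have ha2 : 9 ≤ a ^ 2 := by nlinarith
  have hab : a ^ 2 ≤ a ^ 2 * b := le_mul_of_one_le_right (by positivity) hb
  have hy2 : 4 ≤ y ^ 2 := by nlinarith
  have upper : x < a * b * y := by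
    refine lt_of_pow_lt_pow_left₀ 2 (by positivity) ?_
    nlinarith [mul_pos hb (pow_pos hy0 2)]
  have lower : (a ^ 2 * b - 2) * y < a * x := by
    refine lt_of_pow_lt_pow_left₀ 2 (by positivity) ?_
    have hdiff : (a * x) ^ 2 - ((a ^ 2 * b - 2) * y) ^ 2
        = 2 * (a ^ 2 * b - 2) * y ^ 2 - 4 * a ^ 2 := by
      linear_combination a ^ 2 * h
    have : (a ^ 2 * b - 2) * 4 ≤ (a ^ 2 * b - 2) * y ^ 2 :=
      mul_le_mul_of_nonneg_left hy2 (by linarith)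
    linarith
  rw [abs_lt]
  constructor
  · linarith
  · linarith [mul_lt_mul_of_pos_left upper ha0]

/-- For positive integers `a ≥ 3` and `b`, the Pell equation `x² − (a²b² − 2b)y² = −4`
has no positive integer solutions. -/
theorem pell_neg_four_no_sol_a_sq_b_sq_sub_two_b (a b : ℤ) (ha : 3 ≤ a) (hb : 0 < b) :
    ¬ ∃ x y : ℤ, 0 < x ∧ 0 < y ∧ x ^ 2 - (a ^ 2 * b ^ 2 - 2 * b) * y ^ 2 = -4 := by
  suffices descent : ∀ (n : ℕ) (x y : ℤ), y.natAbs = n → 0 ≤ x → 0 < y →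
      x ^ 2 - (a ^ 2 * b ^ 2 - 2 * b) * y ^ 2 ≠ -4 by
    rintro ⟨x, y, hx, hy, h⟩
    exact descent _ x y rfl hx.le hy h
  intro n
  induction n using Nat.strong_induction_on with
  | _ n ih =>
    intro x y hn hx hy h
    obtain rfl | hy2 : y = 1 ∨ 2 ≤ y := by omega
    · exact sq_ne_a_sq_b_sq_sub_two_b_sub_four ha hb x hx (by linarith)
    have hlt := abs_lt_of_pell_neg_four ha hb hx hy2 h
    have hnew : ((a ^ 2 * b - 1) * x - a * (a ^ 2 * b ^ 2 - 2 * b) * y) ^ 2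
        - (a ^ 2 * b ^ 2 - 2 * b) * (a * x - (a ^ 2 * b - 1) * y) ^ 2 = -4 := by
      linear_combination h
    have hne : a * x - (a ^ 2 * b - 1) * y ≠ 0 := by
      intro h0
      rw [h0] at hnew
      nlinarith [sq_nonneg ((a ^ 2 * b - 1) * x - a * (a ^ 2 * b ^ 2 - 2 * b) * y)]
    refine ih _ ?_ |(a ^ 2 * b - 1) * x - a * (a ^ 2 * b ^ 2 - 2 * b) * y|
      |a * x - (a ^ 2 * b - 1) * y| rfl (abs_nonneg _) (abs_pos.mpr hne) ?_
    · exact hn ▸ Int.natAbs_lt_natAbs_of_nonneg_of_lt (abs_nonneg _) hlt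
    · rwa [sq_abs, sq_abs]
end

section
/- Let k be a positive integer. Then the positive integer solutions of x² − (9k²−6)y² = 1 are exactly the pairs (xₙ, yₙ) = (Vₙ(6k²−2,−1)/2, k·Uₙ(6k²−2,−1)) for n ≥ 1; that is, a pair of positive integers (x, y) satisfies x² − (9k²−6)y² = 1 if and only if there exists n ≥ 1 with 2x = Vₙ(6k²−2,−1) and y = k·Uₙ(6k²−2,−1). -/
open Pell Solution₁

theorem genLucas_two_mul_x {d : ℤ} (a : Solution₁ d) (n : ℕ) :
    genLucas (2 * a.x) (-1) n = 2 * (a ^ n).x := by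
  induction n using Nat.twoStepInduction with
  | zero => simp [genLucas]
  | one => simp [genLucas]
  | more n ih₀ ih₁ =>
    rw [genLucas, ih₀, ih₁]
    simp only [pow_succ, x_mul, y_mul]
    linear_combination (2 * (a ^ n).x) * a.prop

theorem y_mul_genFib_two_mul_x {d : ℤ} (a : Solution₁ d) (n : ℕ) :
    a.y * genFib (2 * a.x) (-1) n = (a ^ n).y := by
  induction n using Nat.twoStepInduction with
  | zero => simp [genFib]
  | one => simp [genFib]
  | more n ih₀ ih₁ =>
    rw [genFib, mul_add, mul_left_comm, ih₁, mul_left_comm, ih₀]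
    simp only [pow_succ, x_mul, y_mul]
    linear_combination (a ^ n).y * a.prop

/-- A solution of `x² − (9k² − 6)y² = 1` in positive integers has `y ≥ k`. -/
theorem le_of_sq_sub_nine_mul_sq_sub_six {k x y : ℤ} (hk : 0 < k) (hx : 0 < x) (hy : 0 < y)
    (h : x ^ 2 - (9 * k ^ 2 - 6) * y ^ 2 = 1) : k ≤ y := by
  by_contra! hlt
  have hlt' : x < 3 * k * y := by
    have : 0 < k * y := mul_pos hk hy
    nlinarith
  nlinarith [mul_nonneg (show 0 ≤ 3 * k * y - x - 1 by linarith)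
    (show 0 ≤ 3 * k * y + x - 1 by nlinarith), mul_pos hy (sub_pos.2 hlt)]

theorem isFundamental_of_nine_mul_sq_sub_six {k : ℤ} (hk : 0 < k)
    (a : Solution₁ (9 * k ^ 2 - 6)) (hx : a.x = 3 * k ^ 2 - 1) (hy : a.y = k) :
    IsFundamental a := by
  refine ⟨by nlinarith, by rwa [hy], fun {b} hb => ?_⟩
  have hle : k ≤ |b.y| :=
    le_of_sq_sub_nine_mul_sq_sub_six hk (by linarith) (abs_pos.2 (y_ne_zero_of_one_lt_x hb))
      (by rw [sq_abs]; exact b.prop)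
  have hsq : a.y ^ 2 ≤ b.y ^ 2 := by
    rw [hy, ← sq_abs b.y]
    gcongr
  refine le_of_sq_le_sq ?_ (by linarith)
  rw [a.prop_x, b.prop_x]
  have : 0 ≤ 9 * k ^ 2 - 6 := by nlinarith
  gcongr

/-- For a positive integer `k`, the positive integer solutions of `x² − (9k² − 6)y² = 1`
are exactly the pairs `(Vₙ(6k²−2,−1)/2, k·Uₙ(6k²−2,−1))` for `n ≥ 1`. -/
theorem pell_sols_nine_k_sq_sub_six (k : ℤ) (hk : 0 < k)
    (x y : ℤ) (hx : 0 < x) (hy : 0 < y) :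
    x ^ 2 - (9 * k ^ 2 - 6) * y ^ 2 = 1 ↔
      ∃ n : ℕ, 1 ≤ n ∧ 2 * x = genLucas (6 * k ^ 2 - 2) (-1) n ∧
        y = k * genFib (6 * k ^ 2 - 2) (-1) n := by
  let a : Solution₁ (9 * k ^ 2 - 6) := .mk (3 * k ^ 2 - 1) k (by ring)
  have ha : IsFundamental a :=
    isFundamental_of_nine_mul_sq_sub_six hk a (x_mk _ _ _) (y_mk _ _ _)
  have hV (n : ℕ) : genLucas (6 * k ^ 2 - 2) (-1) n = 2 * (a ^ n).x := by
    rw [← genLucas_two_mul_x, x_mk]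
    ring_nf
  have hU (n : ℕ) : k * genFib (6 * k ^ 2 - 2) (-1) n = (a ^ n).y := by
    rw [← y_mul_genFib_two_mul_x, x_mk, y_mk]
    ring_nf
  simp only [hV, hU]
  constructor
  · intro h
    obtain ⟨n, hn⟩ := ha.eq_pow_of_nonneg (a := .mk x y h) (by simpa using hx)
      (by simpa using hy.le)
    have hxn : x = (a ^ n).x := by rw [← hn, x_mk]
    have hyn : y = (a ^ n).y := by rw [← hn, y_mk]
    refine ⟨n, Nat.one_le_iff_ne_zero.2 ?_, by rw [hxn], hyn⟩
    rintro rfl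
    simp [hyn] at hy
  · rintro ⟨n, -, hxn, rfl⟩
    rw [mul_left_cancel₀ two_ne_zero hxn]
    exact (a ^ n).prop
end
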